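/- Let M be a positive semidefinite real d×d matrix, let λ_1, …, λ_d be strictly positive reals, and let β > 0. Then the d×d matrix with entries ψ(β(λ_i + λ_j))/(λ_i + λ_j) · M_{ij} is positive semidefinite. -/

import Mathlib

noncomputable def psi (x : ℝ) : ℝ := if x = 0 then 0 else (Real.exp (-x) - 1 + x) / x

open scoped Matrix

/-- An interval integral of real positive semidefinite matrices is positive semidefinite. -/
theorem Matrix.PosSemidef.intervalIntegral {n : Type*} [Fintype n] {a b : ℝ} (hab : a ≤ b)
    {A : ℝ → Matrix n n ℝ} (hA : ∀ t ∈ Set.Icc a b, (A t).PosSemidef)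
    (hint : ∀ i j, IntervalIntegrable (fun t => A t i j) MeasureTheory.volume a b) :
    (Matrix.of fun i j => ∫ t in a..b, A t i j).PosSemidef := by
  refine .of_dotProduct_mulVec_nonneg ?_ fun x => ?_
  · ext i j
    simp only [Matrix.conjTranspose_apply, Matrix.of_apply, star_trivial]
    refine intervalIntegral.integral_congr fun t ht => ?_
    rw [Set.uIcc_of_le hab] at ht
    simpa using (hA t ht).isHermitian.apply i j
  · have key : star x ⬝ᵥ (Matrix.of fun i j => ∫ t in a..b, A t i j) *ᵥ x
        = ∫ t in a..b, star x ⬝ᵥ A t *ᵥ x := by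
      simp only [dotProduct, Matrix.mulVec, Matrix.of_apply, Finset.mul_sum]
      have hterm (i j : n) : IntervalIntegrable (fun t => star x i * (A t i j * x j))
          MeasureTheory.volume a b := ((hint i j).mul_const _).const_mul _
      rw [intervalIntegral.integral_finsetSum fun i _ =>
        by simpa [Finset.sum_fn] using IntervalIntegrable.sum Finset.univ fun j _ => hterm i j]
      refine Finset.sum_congr rfl fun i _ => ?_
      rw [intervalIntegral.integral_finsetSum fun j _ => hterm i j]
      simp
    rw [key]
    exact intervalIntegral.integral_nonneg hab fun t ht => (hA t ht).dotProduct_mulVec_nonneg x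

theorem psi_mul_div_eq_integral {β s : ℝ} (hβ : 0 < β) (hs : 0 < s) :
    psi (β * s) / s = ∫ t in (0 : ℝ)..β, (β - t) / β * Real.exp (-(t * s)) := by
  have hderiv (t : ℝ) : HasDerivAt
      (fun t => (1 / s ^ 2 - (β - t) / s) / β * Real.exp (-(t * s)))
      ((β - t) / β * Real.exp (-(t * s))) t := by
    have h₁ : HasDerivAt (fun t => (1 / s ^ 2 - (β - t) / s) / β) (1 / s / β) t := by
      simpa [neg_div, -one_div] using
        ((((hasDerivAt_id t).const_sub β).div_const s).const_sub (1 / s ^ 2)).div_const β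
    have h₂ : HasDerivAt (fun t => Real.exp (-(t * s))) (Real.exp (-(t * s)) * -s) t := by
      simpa using ((hasDerivAt_id t).mul_const s).neg.exp
    refine (h₁.mul h₂).congr_deriv ?_
    field_simp
    ring
  rw [intervalIntegral.integral_eq_sub_of_hasDerivAt (fun t _ => hderiv t)
    (Continuous.intervalIntegrable (by fun_prop) _ _), psi, if_neg (by positivity)]
  simp only [sub_self, zero_div, sub_zero, zero_mul, neg_zero, Real.exp_zero]
  field_simp
  ring

/-- Let `M` be a positive semidefinite real `d×d` matrix, let `λ_1, …, λ_d` be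
strictly positive reals, and let `β > 0`. Then the `d×d` matrix with entries
`ψ(β(λ_i + λ_j))/(λ_i + λ_j) · M_{ij}` is positive semidefinite. -/
theorem psi_rescaled_posSemidef (d : ℕ) (hd : 1 ≤ d) (M : Matrix (Fin d) (Fin d) ℝ)
    (hM : M.PosSemidef) (lam : Fin d → ℝ) (hlam : ∀ i, 0 < lam i)
    (β : ℝ) (hβ : 0 < β) :
    (Matrix.of fun i j : Fin d =>
      psi (β * (lam i + lam j)) / (lam i + lam j) * M i j).PosSemidef := by
  have hexp (t : ℝ) (ht : t ∈ Set.Icc 0 β) :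
      (((β - t) / β) • Matrix.vecMulVec (fun i => Real.exp (-(t * lam i)))
        (star fun i => Real.exp (-(t * lam i)))).PosSemidef :=
    (Matrix.posSemidef_vecMulVec_self_star _).smul (div_nonneg (sub_nonneg.2 ht.2) hβ.le)
  have hkernel := Matrix.PosSemidef.intervalIntegral hβ.le hexp fun i j =>
    Continuous.intervalIntegrable (by simp [Matrix.vecMulVec_apply]; fun_prop) _ _
  refine (congrArg Matrix.PosSemidef ?_).mpr (hkernel.hadamard hM)
  ext i j
  rw [Matrix.hadamard_apply, Matrix.of_apply, Matrix.of_apply,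
    psi_mul_div_eq_integral hβ (add_pos (hlam i) (hlam j))]
  simp [Matrix.vecMulVec_apply, mul_add, Real.exp_add, mul_comm]
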